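/- Let 𝒜 be a set of ordered graphs. If 𝒜 contains a left-star and a right-broom, or 𝒜 contains a right-star and a left-broom, then 𝒜 has the sparse rainbow strong EH-property. -/

import Mathlib

/-- A blockade: a family of pairwise disjoint nonempty blocks. -/
def IsBlockade {n k : ℕ} (B : Fin k → Finset (Fin n)) : Prop :=
  (∀ i, (B i).Nonempty) ∧ ∀ i j : Fin k, i ≠ j → Disjoint (B i) (B j)

/-- The width of a blockade: the minimum cardinality of a block. -/
noncomputable def blockadeWidth {n k : ℕ} (B : Fin k → Finset (Fin n)) : ℕ :=
  ⨅ i, (B i).card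
/-- Containment of ordered graphs (graphs on `Fin m` with the natural numbering):
an induced subgraph with the induced numbering is isomorphic to `H` as an ordered graph. -/
def OContains {n m : ℕ} (G : SimpleGraph (Fin n)) (H : SimpleGraph (Fin m)) : Prop :=
  ∃ f : Fin m → Fin n, StrictMono f ∧ ∀ u v, H.Adj u v ↔ G.Adj (f u) (f v)
/-- A blockade respects the numbering: blocks occur consecutively in order. -/
def Respectful {n k : ℕ} (B : Fin k → Finset (Fin n)) : Prop :=
  ∀ i j : Fin k, i < j → ∀ u ∈ B i, ∀ v ∈ B j, u < v

/-- A rainbow copy of the ordered graph `H` in the ordered graph `G`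
with respect to the blockade `B`. -/
def ORainbow {n m k : ℕ} (G : SimpleGraph (Fin n)) (H : SimpleGraph (Fin m))
    (B : Fin k → Finset (Fin n)) : Prop :=
  ∃ f : Fin m → Fin n, StrictMono f ∧ (∀ u v, H.Adj u v ↔ G.Adj (f u) (f v)) ∧
    ∃ β : Fin m → Fin k, Function.Injective β ∧ ∀ u, f u ∈ B (β u)

/-- The degree of a vertex in a graph. -/
noncomputable def gdeg {n : ℕ} (G : SimpleGraph (Fin n)) (v : Fin n) : ℕ :=
  Nat.card {u : Fin n | G.Adj v u}

/-- An anticomplete pair of order at least `t` in a graph. -/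
def HasAnticompletePair {n : ℕ} (G : SimpleGraph (Fin n)) (t : ℝ) : Prop :=
  ∃ A B : Finset (Fin n), Disjoint A B ∧ (∀ a ∈ A, ∀ b ∈ B, ¬ G.Adj a b) ∧
    t ≤ A.card ∧ t ≤ B.card

/-- An ordered graph: a graph on `Fin m`, carrying the natural numbering. -/
abbrev OGraph := Σ m : ℕ, SimpleGraph (Fin m)

/-- The sparse rainbow strong EH-property for a set of ordered graphs. -/
def SRSEH (𝒜 : Set OGraph) : Prop :=
  ∃ c : ℝ, 0 < c ∧ c < 1 ∧
    ∀ (n k : ℕ) (G : SimpleGraph (Fin n)) (B : Fin k → Finset (Fin n)),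
      IsBlockade B → Respectful B → 1 / c ≤ (k : ℝ) →
      (∀ H ∈ 𝒜, ¬ ORainbow G H.2 B) →
      (∀ v, (gdeg G v : ℝ) < c * blockadeWidth B) →
      HasAnticompletePair G (c * blockadeWidth B)
/-- A left-star: the first vertex is adjacent to every other vertex, and every edge is
incident with the first vertex. -/
def IsLeftStar {n : ℕ} (G : SimpleGraph (Fin n)) : Prop :=
  0 < n ∧ ∀ i j : Fin n, G.Adj i j ↔ (i ≠ j ∧ (i.val = 0 ∨ j.val = 0))

/-- A right-star: the last vertex is adjacent to every other vertex, and every edge is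
incident with the last vertex. -/
def IsRightStar {n : ℕ} (G : SimpleGraph (Fin n)) : Prop :=
  0 < n ∧ ∀ i j : Fin n, G.Adj i j ↔ (i ≠ j ∧ (i.val = n - 1 ∨ j.val = n - 1))
/-- A left-broom: a monotone path `v₁‐v₂‐⋯‐vₘ` followed by a star at `vₘ` on the
remaining (later) vertices. -/
def IsLeftBroom {n : ℕ} (G : SimpleGraph (Fin n)) : Prop :=
  0 < n ∧ ∃ m : ℕ, 1 ≤ m ∧ m ≤ n ∧
    ∀ i j : Fin n, i < j →
      (G.Adj i j ↔ ((j.val = i.val + 1 ∧ j.val ≤ m - 1) ∨ (i.val = m - 1 ∧ m ≤ j.val)))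

/-- A right-broom: an ordered graph which becomes a left-broom when its numbering
is reversed. -/
def IsRightBroom {n : ℕ} (G : SimpleGraph (Fin n)) : Prop :=
  IsLeftBroom (SimpleGraph.comap Fin.rev G)

namespace StarBroom
open Finset Classical

/-- `x` is nonadjacent to, and in a different block from, every vertex of `Z`. -/
def Free {V : Type} (G : SimpleGraph V) (β : V → ℕ) (x : V) (Z : Set V) : Prop :=
  ∀ z ∈ Z, ¬ G.Adj x z ∧ β x ≠ β z

/-- Right-star certificate: `a` leaves to the left of the centre `v`. -/
def SC {V : Type} (G : SimpleGraph V) (β : V → ℕ) (a : ℕ) (v : V) (Z : Set V) : Prop :=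
  ∃ S : Finset V, #S = a ∧ (∀ x ∈ S, G.Adj x v ∧ β x < β v ∧ Free G β x Z) ∧
    ∀ x ∈ S, ∀ y ∈ S, x ≠ y → ¬ G.Adj x y ∧ β x ≠ β y

/-- Left-broom certificate: path with `s` edges ending in `v`, and `b` leaves right of `v`. -/
def BC {V : Type} (G : SimpleGraph V) (β : V → ℕ) (s b : ℕ) (v : V) (Z : Set V) : Prop :=
  ∃ (w : ℕ → V) (S : Finset V), w s = v ∧
    (∀ i j, i < j → j ≤ s → β (w i) < β (w j) ∧ (G.Adj (w i) (w j) ↔ j = i + 1)) ∧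
    (∀ i, i < s → Free G β (w i) Z) ∧ #S = b ∧
    (∀ x ∈ S, G.Adj x v ∧ β v < β x ∧ Free G β x Z ∧ ∀ i, i < s → ¬ G.Adj (w i) x) ∧
    ∀ x ∈ S, ∀ y ∈ S, x ≠ y → ¬ G.Adj x y ∧ β x ≠ β y

/-- union of the blocks in `Q`. -/
def ZU {V : Type} (Q : Finset ℕ) (C : ℕ → Finset V) : Set V := {z | ∃ q ∈ Q, z ∈ C q}

/-- covered part -/
noncomputable def cv {V : Type} (G : SimpleGraph V) (X D : Finset V) : Finset V :=
  D.filter (fun u => ∃ x ∈ X, G.Adj x u)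
/-- uncovered part -/
noncomputable def uc {V : Type} (G : SimpleGraph V) (X D : Finset V) : Finset V :=
  D.filter (fun u => ¬ ∃ x ∈ X, G.Adj x u)

section
variable {V : Type} {G : SimpleGraph V} {β : V → ℕ}

lemma Free.mono {x : V} {Z Z' : Set V} (h : Free G β x Z) (hZ : Z' ⊆ Z) : Free G β x Z' :=
  fun z hz => h z (hZ hz)

lemma ZU_mono {Q Q' : Finset ℕ} {C C' : ℕ → Finset V} (hQ : Q' ⊆ Q) (hC : ∀ k ∈ Q', C' k ⊆ C k) :
    ZU Q' C' ⊆ ZU Q C := by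
  rintro z ⟨q, hq, hz⟩
  exact ⟨q, hQ hq, hC q hq hz⟩

lemma cv_subset (X D : Finset V) : cv G X D ⊆ D := filter_subset _ _
lemma uc_subset (X D : Finset V) : uc G X D ⊆ D := filter_subset _ _
lemma mem_cv {X D : Finset V} {u : V} : u ∈ cv G X D ↔ u ∈ D ∧ ∃ x ∈ X, G.Adj x u := by
  simp [cv]
lemma mem_uc {X D : Finset V} {u : V} : u ∈ uc G X D ↔ u ∈ D ∧ ∀ x ∈ X, ¬ G.Adj x u := by
  simp [uc]
lemma cv_add_uc (X D : Finset V) : #(cv G X D) + #(uc G X D) = #D := by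
  unfold cv uc; exact card_filter_add_card_filter_not _
lemma cv_mono {X D D' : Finset V} (h : D' ⊆ D) : cv G X D' ⊆ cv G X D := filter_subset_filter _ h
lemma uc_mono {X D D' : Finset V} (h : D' ⊆ D) : uc G X D' ⊆ uc G X D := filter_subset_filter _ h

lemma SC.mono {a : ℕ} {v : V} {Z Z' : Set V} (h : SC G β a v Z) (hZ : Z' ⊆ Z) :
    SC G β a v Z' := by
  obtain ⟨S, h1, h2, h3⟩ := h
  exact ⟨S, h1, fun x hx => ⟨(h2 x hx).1, (h2 x hx).2.1, (h2 x hx).2.2.mono hZ⟩, h3⟩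

lemma BC.mono {s b : ℕ} {v : V} {Z Z' : Set V} (h : BC G β s b v Z) (hZ : Z' ⊆ Z) :
    BC G β s b v Z' := by
  obtain ⟨w, S, h1, h2, h3, h4, h5, h6⟩ := h
  exact ⟨w, S, h1, h2, fun i hi => (h3 i hi).mono hZ, h4,
    fun x hx => ⟨(h5 x hx).1, (h5 x hx).2.1, (h5 x hx).2.2.1.mono hZ, (h5 x hx).2.2.2⟩, h6⟩

lemma SC.less {a a' : ℕ} {v : V} {Z : Set V} (h : SC G β a v Z) (ha : a' ≤ a) :
    SC G β a' v Z := by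
  obtain ⟨S, h1, h2, h3⟩ := h
  obtain ⟨S', hS', hc⟩ := exists_subset_card_eq (h1 ▸ ha : a' ≤ #S)
  exact ⟨S', hc, fun x hx => h2 x (hS' hx), fun x hx y hy => h3 x (hS' hx) y (hS' hy)⟩

lemma BC.less {s b b' : ℕ} {v : V} {Z : Set V} (h : BC G β s b v Z) (hb : b' ≤ b) :
    BC G β s b' v Z := by
  obtain ⟨w, S, h1, h2, h3, h4, h5, h6⟩ := h
  obtain ⟨S', hS', hc⟩ := exists_subset_card_eq (h4 ▸ hb : b' ≤ #S)
  exact ⟨w, S', h1, h2, h3, hc, fun x hx => h5 x (hS' hx),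
    fun x hx y hy => h6 x (hS' hx) y (hS' hy)⟩

lemma SC.zero (v : V) (Z : Set V) : SC G β 0 v Z := ⟨∅, by simp⟩
lemma BC.zero (v : V) (Z : Set V) : BC G β 0 0 v Z := by
  refine ⟨fun _ => v, ∅, rfl, ?_, ?_, by simp⟩
  · intro i j h1 h2; omega
  · intro i h1; omega

lemma SC.leaf {a : ℕ} {v x : V} {Z Z' : Set V} (h : SC G β a v Z) (hZ : Z' ⊆ Z) (hx : x ∈ Z)
    (hxv : G.Adj x v) (hl : β x < β v) (hf : Free G β x Z') : SC G β (a + 1) v Z' := by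
  obtain ⟨S, h1, h2, h3⟩ := h
  have hxS : x ∉ S := fun hh => ((h2 x hh).2.2 x hx).2 rfl
  refine ⟨insert x S, by rw [card_insert_of_notMem hxS, h1], ?_, ?_⟩
  · intro y hy
    rcases mem_insert.1 hy with rfl | hy
    · exact ⟨hxv, hl, hf⟩
    · exact ⟨(h2 y hy).1, (h2 y hy).2.1, (h2 y hy).2.2.mono hZ⟩
  · intro y hy z hz hne
    rcases mem_insert.1 hy with rfl | hy2 <;> rcases mem_insert.1 hz with rfl | hz2
    · exact absurd rfl hne
    · have := (h2 z hz2).2.2 y hx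
      exact ⟨fun e => this.1 e.symm, this.2.symm⟩
    · exact (h2 y hy2).2.2 z hx
    · exact h3 y hy2 z hz2 hne

lemma BC.leaf {s b : ℕ} {v x : V} {Z Z' : Set V} (h : BC G β s b v Z) (hZ : Z' ⊆ Z) (hx : x ∈ Z)
    (hxv : G.Adj x v) (hl : β v < β x) (hf : Free G β x Z') : BC G β s (b + 1) v Z' := by
  obtain ⟨w, S, h1, h2, h3, h4, h5, h6⟩ := h
  have hxS : x ∉ S := fun hh => ((h5 x hh).2.2.1 x hx).2 rfl
  refine ⟨w, insert x S, h1, h2, fun i hi => (h3 i hi).mono hZ,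
    by rw [card_insert_of_notMem hxS, h4], ?_, ?_⟩
  · intro y hy
    rcases mem_insert.1 hy with rfl | hy
    · exact ⟨hxv, hl, hf, fun i hi => ((h3 i hi) y hx).1⟩
    · exact ⟨(h5 y hy).1, (h5 y hy).2.1, (h5 y hy).2.2.1.mono hZ, (h5 y hy).2.2.2⟩
  · intro y hy z hz hne
    rcases mem_insert.1 hy with rfl | hy2 <;> rcases mem_insert.1 hz with rfl | hz2
    · exact absurd rfl hne
    · have := (h5 z hz2).2.2.1 y hx
      exact ⟨fun e => this.1 e.symm, this.2.symm⟩
    · exact (h5 y hy2).2.2.1 z hx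
    · exact h6 y hy2 z hz2 hne

lemma BC.path {s b : ℕ} {v x : V} {Z Z' : Set V} (h : BC G β s b v Z) (hZ : Z' ⊆ Z) (hx : x ∈ Z)
    (hxv : G.Adj v x) (hl : β v < β x) (hf : Free G β v Z') : BC G β (s + 1) 0 x Z' := by
  obtain ⟨w, S, h1, h2, h3, h4, h5, h6⟩ := h
  refine ⟨fun i => if i ≤ s then w i else x, ∅, by simp, ?_, ?_, by simp, by simp, by simp⟩
  · intro i j hij hj
    have hi : i ≤ s := by omega
    simp only [hi, if_true]
    by_cases hjs : j ≤ s
    · simp only [hjs, if_true]; exact h2 i j hij hjs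
    · simp only [hjs, if_false]
      have hj' : j = s + 1 := by omega
      subst hj'
      rcases Nat.lt_or_eq_of_le hi with hi' | rfl
      · refine ⟨?_, ?_⟩
        · have := (h2 i s hi' le_rfl).1
          rw [h1] at this; omega
        · constructor
          · intro e; exact absurd e ((h3 i hi') x hx).1
          · intro e; omega
      · rw [h1]; exact ⟨hl, by simp [hxv]⟩
  · intro i hi
    have hi' : i ≤ s := by omega
    simp only [hi', if_true]
    rcases Nat.lt_or_eq_of_le hi' with hi'' | rfl
    · exact (h3 i hi'').mono hZ
    · rw [h1]; exact hf

/-- Minimal cover lemma. -/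
lemma minCover {h l : ℝ} (hh : 0 < h) (hl : 1 ≤ l)
    (H1 : ∀ v : V, ∀ D : Finset V, (#(D.filter (fun u => G.Adj v u)) : ℝ) ≤ h)
    (H2 : ∀ A D : Finset V, Disjoint A D → (∀ a ∈ A, ∀ d ∈ D, ¬ G.Adj a d) → h ≤ #A → (#D : ℝ) < h)
    (A : Finset V) (hA : h ≤ #A) (T : Finset ℕ) (D : ℕ → Finset V)
    (hD : ∀ q ∈ T, 3 * l * h ≤ #(D q)) (hdis : ∀ q ∈ T, Disjoint A (D q))
    (Φ : Finset ℕ → Prop) (hΦT : Φ T) (hΦ0 : ¬ Φ ∅) :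
    ∃ X ⊆ A, Φ (T.filter (fun q => l * h ≤ #(cv G X (D q)))) ∧
      ∃ S ⊆ T, ¬ Φ S ∧ ∀ q ∈ T, q ∉ S → l * h ≤ #(uc G X (D q)) := by
  have hlh : h ≤ l * h := by nlinarith
  have hex : ∃ X ∈ A.powerset, Φ (T.filter (fun q => l * h ≤ #(cv G X (D q)))) := by
    refine ⟨A, by simp, ?_⟩
    convert hΦT
    apply filter_true_of_mem
    intro q hq
    have h1 := H2 A (uc G A (D q)) ((hdis q hq).mono_right (uc_subset _ _))
      (fun a ha d hd => (mem_uc.1 hd).2 a ha) hA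
    have h2 := cv_add_uc (G := G) A (D q)
    have h3 := hD q hq
    rw [← h2] at h3; push_cast at h3
    nlinarith
  obtain ⟨X, hX, hmin⟩ := exists_min_image
    (A.powerset.filter (fun X => Φ (T.filter (fun q => l * h ≤ #(cv G X (D q))))))
    (fun X => #X) (by obtain ⟨X, h1, h2⟩ := hex; exact ⟨X, mem_filter.2 ⟨h1, h2⟩⟩)
  simp only [mem_filter, mem_powerset] at hX hmin
  have hne : X.Nonempty := by
    rw [nonempty_iff_ne_empty]
    rintro rfl
    apply hΦ0
    convert hX.2
    symm
    apply filter_false_of_mem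
    intro q hq
    have : cv G ∅ (D q) = ∅ := by ext; simp [mem_cv]
    rw [this]; simp; nlinarith
  obtain ⟨x, hx⟩ := hne
  refine ⟨X, hX.1, hX.2, T.filter (fun q => l * h ≤ #(cv G (X.erase x) (D q))),
    filter_subset _ _, ?_, ?_⟩
  · intro hc
    have := hmin (X.erase x) ⟨(erase_subset _ _).trans hX.1, hc⟩
    have := card_erase_lt_of_mem hx
    omega
  · intro q hq hqS
    have h0 : (#(cv G (X.erase x) (D q)) : ℝ) < l * h := by
      by_contra hcon
      exact hqS (mem_filter.2 ⟨hq, not_lt.1 hcon⟩)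
    have h1 : cv G X (D q) ⊆ cv G (X.erase x) (D q) ∪ (D q).filter (fun u => G.Adj x u) := by
      intro u hu
      obtain ⟨hu1, y, hy, hyu⟩ := mem_cv.1 hu
      by_cases hyx : y = x
      · subst hyx; exact mem_union_right _ (mem_filter.2 ⟨hu1, hyu⟩)
      · exact mem_union_left _ (mem_cv.2 ⟨hu1, y, mem_erase.2 ⟨hyx, hy⟩, hyu⟩)
    have h2 : (#(cv G X (D q)) : ℝ) ≤ #(cv G (X.erase x) (D q)) + h := by
      have := (card_le_card h1).trans (card_union_le _ _)
      have h' : (#(cv G X (D q)) : ℝ) ≤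
        #(cv G (X.erase x) (D q)) + #((D q).filter (fun u => G.Adj x u)) := by exact_mod_cast this
      linarith [H1 x (D q)]
    have h3 := hD q hq
    rw [← cv_add_uc (G := G) X (D q)] at h3; push_cast at h3
    nlinarith
end
end StarBroom

namespace StarBroom
open Finset Classical

/-- hereditary strong preference of `j` for `Q` over `i` -/
def SR {V : Type} (G : SimpleGraph V) (h : ℝ) (n i j : ℕ) (Q : Finset ℕ) (C : ℕ → Finset V) : Prop :=
  ∀ X ⊆ C j, 3 ^ n * h ≤ #(cv G X (C i)) → #(Q.filter (fun q => 3 ^ n * h ≤ #(uc G X (C q)))) < n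

lemma SR.mono {V : Type} {G : SimpleGraph V} {h : ℝ} (hh : 0 < h) {n n' i j : ℕ} {Q Q' : Finset ℕ}
    {C C' : ℕ → Finset V} (hs : SR G h n i j Q C) (hn : n ≤ n') (hQ : Q' ⊆ Q)
    (hC : ∀ k, C' k ⊆ C k) : SR G h n' i j Q' C' := by
  intro X hX hc
  have hp : (3 : ℝ) ^ n * h ≤ 3 ^ n' * h := by
    gcongr; norm_num
  have h1 := hs X (hX.trans (hC j)) (by
    refine hp.trans (hc.trans ?_)
    exact_mod_cast card_le_card (cv_mono (hC i)))
  refine lt_of_le_of_lt (card_le_card ?_) (lt_of_lt_of_le h1 hn)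
  intro q hq
  rw [mem_filter] at hq ⊢
  refine ⟨hQ hq.1, hp.trans (hq.2.trans ?_)⟩
  exact_mod_cast card_le_card (uc_mono (hC q))

lemma link (s tb : ℕ) (g : ℕ → ℕ) (n0 : ℕ) : ∀ r : ℕ, ∃ N : ℕ,
    ∀ (V : Type) (G : SimpleGraph V) (β : V → ℕ) (h : ℝ), 0 < h →
    (∀ v Z, ¬ BC G β s tb v Z) →
    ∀ (i : ℕ) (Q : Finset ℕ) (C : ℕ → Finset V) (b : ℕ), b + r = tb →
    (∀ k, ∀ v ∈ C k, β v = k) → (∀ q ∈ Q, i < q) → N ≤ #Q →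
    (3 ^ N * h ≤ #(C i)) → (∀ q ∈ Q, 3 ^ N * h ≤ #(C q)) →
    (∀ v ∈ C i, BC G β s b v (ZU Q C)) →
    ∃ n', n0 ≤ n' ∧ g n' ≤ N ∧ ∃ Q' ⊆ Q, ∃ C' : ℕ → Finset V, (∀ k, C' k ⊆ C k) ∧
      g n' ≤ #Q' ∧ (3 ^ (g n') * h ≤ #(C' i)) ∧ (∀ q ∈ Q', 3 ^ (g n') * h ≤ #(C' q)) ∧
      ∀ j ∈ Q', SR G h n' i j (Q'.filter (fun q => j < q)) C' := by
  intro r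
  induction r with
  | zero =>
    refine ⟨0, ?_⟩
    intro V G β h hh hb i Q C b hbr hβ hi hN hCi hCQ hcert
    exfalso
    have : (0 : ℝ) < #(C i) := by
      refine lt_of_lt_of_le ?_ hCi; positivity
    obtain ⟨v, hv⟩ := card_pos.1 (by exact_mod_cast this)
    have := hcert v hv
    rw [show b = tb by omega] at this
    exact hb _ _ this
  | succ r ih =>
    obtain ⟨Nr, ih⟩ := ih
    refine ⟨max (g (max Nr n0)) (max Nr (g (max Nr n0))), ?_⟩
    set n1 := max Nr n0 with hn1
    set N := max (g n1) (max Nr (g n1)) with hNdef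
    intro V G β h hh hb i Q C b hbr hβ hi hN hCi hCQ hcert
    have hp : ∀ {x y : ℕ}, x ≤ y → (3 : ℝ) ^ x * h ≤ 3 ^ y * h := by
      intro x y hxy; gcongr; norm_num
    by_cases hall : ∀ j ∈ Q, SR G h n1 i j (Q.filter (fun q => j < q)) C
    · refine ⟨n1, le_max_right _ _, le_max_left _ _, Q, Subset.rfl, C, fun _ => Subset.rfl,
        (le_max_left _ _).trans hN, (hp (le_max_left _ _)).trans hCi,
        fun q hq => (hp (le_max_left _ _)).trans (hCQ q hq), hall⟩
    · push Not at hall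
      obtain ⟨j, hj, hns⟩ := hall
      unfold SR at hns
      push Not at hns
      obtain ⟨X, hX, hXc, hXu⟩ := hns
      set Q1 := ((Q.filter (fun q => j < q)).filter (fun q => 3 ^ n1 * h ≤ #(uc G X (C q)))) with hQ1
      have hQ1Q : Q1 ⊆ Q := (filter_subset _ _).trans (filter_subset _ _)
      have hiQ : i ∉ Q := fun hh => lt_irrefl _ (hi i hh)
      set C1 : ℕ → Finset V := fun k => if k = i then cv G X (C i) else uc G X (C k) with hC1
      have hC1i : C1 i = cv G X (C i) := by simp [hC1]
      have hC1q : ∀ q ∈ Q, C1 q = uc G X (C q) := by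
        intro q hq
        have : q ≠ i := fun e => hiQ (e ▸ hq)
        simp [hC1, this]
      have hC1C : ∀ k, C1 k ⊆ C k := by
        intro k
        simp only [hC1]
        split_ifs with hk
        · subst hk; exact cv_subset _ _
        · exact uc_subset _ _
      have hsub : ZU Q1 C1 ⊆ ZU Q C := ZU_mono hQ1Q (fun k _ => hC1C k)
      obtain ⟨n', hn', hgn, Q', hQ', C', hC', h1, h2, h3, h4⟩ :=
        ih V G β h hh hb i Q1 C1 (b + 1) (by omega) (fun k v hv => hβ k v (hC1C k hv))
          (fun q hq => hi q (hQ1Q hq)) ((le_max_left _ _).trans hXu)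
          (by rw [hC1i]; exact (hp (le_max_left _ _)).trans hXc)
          (by
            intro q hq
            rw [hC1q q (hQ1Q hq)]
            exact (hp (le_max_left _ _)).trans (mem_filter.1 hq).2)
          (by
            intro v hv
            rw [hC1i] at hv
            obtain ⟨hv1, x, hx, hxv⟩ := mem_cv.1 hv
            refine (hcert v hv1).leaf hsub ⟨j, hj, hX hx⟩ hxv ?_ ?_
            · rw [hβ i v hv1, hβ j x (hX hx)]; exact hi j hj
            · rintro z ⟨q, hq, hz⟩
              rw [hC1q q (hQ1Q hq)] at hz
              obtain ⟨hz1, hz2⟩ := mem_uc.1 hz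
              refine ⟨hz2 x hx, ?_⟩
              rw [hβ j x (hX hx), hβ q z hz1]
              exact ne_of_lt (mem_filter.1 (mem_filter.1 hq).1).2)
      exact ⟨n', hn', hgn.trans ((le_max_left _ _).trans (le_max_right _ _)), Q', hQ'.trans hQ1Q, C',
        fun k => (hC' k).trans (hC1C k), h1, h2, h3, h4⟩

end StarBroom

namespace StarBroom
open Finset Classical

lemma chain (s tb : ℕ) (g : ℕ → ℕ) : ∀ r n0 : ℕ, ∃ N : ℕ,
    ∀ (V : Type) (G : SimpleGraph V) (β : V → ℕ) (h : ℝ), 0 < h →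
    (∀ v Z, ¬ BC G β s tb v Z) →
    ∀ (U : Finset ℕ) (C : ℕ → Finset V),
    (∀ k, ∀ v ∈ C k, β v = k) → N ≤ #U →
    (∀ q ∈ U, 3 ^ N * h ≤ #(C q)) →
    (∀ k ∈ U, ∀ v ∈ C k, BC G β s 0 v (ZU (U.erase k) C)) →
    ∃ n, n0 ≤ n ∧ g n ≤ N ∧ ∃ I ⊆ U, ∃ Q ⊆ U, ∃ C' : ℕ → Finset V, (∀ k, C' k ⊆ C k) ∧
      #I = r ∧ (∀ i ∈ I, ∀ q ∈ Q, i < q) ∧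
      g n ≤ #Q ∧ (∀ q ∈ I, 3 ^ (g n) * h ≤ #(C' q)) ∧ (∀ q ∈ Q, 3 ^ (g n) * h ≤ #(C' q)) ∧
      ∀ i ∈ I, ∀ j ∈ I, i < j → SR G h n i j Q C' := by
  intro r
  induction r with
  | zero =>
    intro n0
    refine ⟨g n0, ?_⟩
    intro V G β h hh hb U C hβ hN hsz hcert
    exact ⟨n0, le_rfl, le_rfl, ∅, empty_subset _, U, Subset.rfl, C, fun _ => Subset.rfl, rfl,
      by simp, hN, by simp, hsz, by simp⟩
  | succ r ih =>
    intro n0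
    choose Nr ih using ih
    obtain ⟨N1, hlink⟩ := link s tb Nr n0 tb
    refine ⟨N1 + 1, ?_⟩
    intro V G β h hh hb U C hβ hN hsz hcert
    have hp : ∀ {x y : ℕ}, x ≤ y → (3 : ℝ) ^ x * h ≤ 3 ^ y * h := by
      intro x y hxy; gcongr; norm_num
    have hUne : U.Nonempty := card_pos.1 (by omega)
    set i := U.min' hUne with hi
    have hiU : i ∈ U := min'_mem _ _
    obtain ⟨n1, hn1, hgn1, Q', hQ', C', hC', h1, h2, h3, h4⟩ :=
      hlink V G β h hh hb i (U.erase i) C 0 (by omega) hβ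
        (fun q hq => lt_of_le_of_ne (min'_le _ _ (mem_of_mem_erase hq)) (ne_of_mem_erase hq).symm)
        (by rw [card_erase_of_mem hiU]; omega)
        ((hp (by omega)).trans (hsz i hiU))
        (fun q hq => (hp (by omega)).trans (hsz q (mem_of_mem_erase hq)))
        (hcert i hiU)
    have hQU : Q' ⊆ U := hQ'.trans (erase_subset _ _)
    obtain ⟨n, hn, hgn, I, hI, Q, hQ, C2, hC2, k1, k2, k3, k4, k5, k6⟩ :=
      ih n1 V G β h hh hb Q' C' (fun k v hv => hβ k v (hC' k hv)) h1 h3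
        (by
          intro k hk v hv
          refine (hcert k (hQU hk) v (hC' k hv)).mono (ZU_mono ?_ (fun q _ => hC' q))
          exact erase_subset_erase _ hQU)
    have hiQ' : i ∉ Q' := fun e => (ne_of_mem_erase (hQ' e)) rfl
    have hlt : ∀ q ∈ Q', i < q := fun q hq =>
      lt_of_le_of_ne (min'_le _ _ (hQU hq)) (ne_of_mem_erase (hQ' hq)).symm
    have hu : ∀ q ∈ Q', Function.update C2 i (C' i) q = C2 q := by
      intro q hq
      exact Function.update_of_ne (hlt q hq).ne' _ _
    have hsub : ∀ k, Function.update C2 i (C' i) k ⊆ C' k := by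
      intro k
      by_cases hk : k = i
      · subst hk; simp
      · rw [Function.update_of_ne hk]; exact hC2 k
    refine ⟨n, hn1.trans hn, by omega, insert i I, insert_subset hiU (hI.trans hQU), Q, hQ.trans hQU,
      Function.update C2 i (C' i), fun k => (hsub k).trans (hC' k), ?_, ?_, k3, ?_, ?_, ?_⟩
    · rw [card_insert_of_notMem (fun e => hiQ' (hI e)), k1]
    · intro a ha q hq
      rcases mem_insert.1 ha with rfl | ha
      · exact hlt q (hQ hq)
      · exact k2 a ha q hq
    · intro a ha
      rcases mem_insert.1 ha with rfl | ha
      · rw [Function.update_self]; exact (hp hgn).trans h2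
      · rw [hu a (hI ha)]; exact k4 a ha
    · intro q hq
      rw [hu q (hQ hq)]; exact k5 q hq
    · intro a ha b hb' hab
      have hbI : b ∈ I := by
        rcases mem_insert.1 hb' with rfl | hb'
        · rcases mem_insert.1 ha with rfl | ha
          · exact absurd hab (lt_irrefl _)
          · exact absurd hab (not_lt.2 (hlt a (hI ha)).le)
        · exact hb'
      rcases mem_insert.1 ha with rfl | ha
      · exact (h4 b (hI hbI)).mono hh hn
          (fun q hq => mem_filter.2 ⟨hQ hq, k2 b hbI q hq⟩) hsub
      · intro X hX hc
        rw [hu b (hI hbI)] at hX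
        rw [hu a (hI ha)] at hc
        have := k6 a ha b hbI hab X hX hc
        refine lt_of_le_of_lt (card_le_card ?_) this
        intro q hq
        rw [mem_filter] at hq ⊢
        rw [hu q (hQ hq.1)] at hq
        exact hq

lemma final (ta n : ℕ) {V : Type} {G : SimpleGraph V} {β : V → ℕ} {h : ℝ} (hh : 0 < h)
    (H1 : ∀ v : V, ∀ D : Finset V, (#(D.filter (fun u => G.Adj v u)) : ℝ) ≤ h)
    (H2 : ∀ A D : Finset V, Disjoint A D → (∀ a ∈ A, ∀ d ∈ D, ¬ G.Adj a d) → h ≤ #A → (#D : ℝ) < h)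
    (hs : ∀ v Z, ¬ SC G β ta v Z) :
    ∀ (r a : ℕ) (I Q : Finset ℕ) (C : ℕ → Finset V), a + r = ta → #I = r →
    (∀ k, ∀ v ∈ C k, β v = k) → (∀ i ∈ I, ∀ q ∈ Q, i < q) → (n + 1) * 2 ^ r ≤ #Q →
    (∀ q ∈ I, 3 ^ (n + r) * h ≤ #(C q)) → (∀ q ∈ Q, 3 ^ (n + r) * h ≤ #(C q)) →
    (∀ i ∈ I, ∀ j ∈ I, i < j → SR G h n i j Q C) →
    (∀ k ∈ Q, ∀ v ∈ C k, SC G β a v (ZU I C)) → False := by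
  intro r
  induction r with
  | zero =>
    intro a I Q C har hI hβ hIQ hQ hsI hsQ hSR hcert
    obtain ⟨k, hk⟩ := card_pos.1 (show 0 < #Q by simp at hQ; omega)
    have : (0 : ℝ) < #(C k) := by
      refine lt_of_lt_of_le ?_ (hsQ k hk); positivity
    obtain ⟨v, hv⟩ := card_pos.1 (by exact_mod_cast this)
    have := hcert k hk v hv
    rw [show a = ta by omega] at this
    exact hs _ _ this
  | succ r ih =>
    intro a I Q C har hI hβ hIQ hQ hsI hsQ hSR hcert
    have hIne : I.Nonempty := card_pos.1 (by omega)
    set j := I.max' hIne with hj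
    have hjI : j ∈ I := max'_mem _ _
    set q' := (n + 1) * 2 ^ r with hq'
    have hq'1 : n + 1 ≤ q' := Nat.le_mul_of_pos_right _ (by positivity)
    have hQ2 : 2 * q' ≤ #Q := by rw [pow_succ] at hQ; rw [hq']; linarith
    have hlt : ∀ i ∈ I.erase j, i < j := fun i hi =>
      lt_of_le_of_ne (le_max' _ _ (mem_of_mem_erase hi)) (ne_of_mem_erase hi)
    have hone : (1 : ℝ) ≤ 3 ^ (n + r) := one_le_pow₀ (by norm_num)
    have hpow : (3 : ℝ) ^ (n + (r + 1)) = 3 * 3 ^ (n + r) := by ring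
    have hnr : (3 : ℝ) ^ n * h ≤ 3 ^ (n + r) * h := by gcongr <;> norm_num
    have hjQ : j ∉ Q := fun e => lt_irrefl _ (hIQ j hjI j e)
    obtain ⟨X, hX, hΦ, S, hS, hnS, hunc⟩ := minCover hh hone H1 H2 (C j)
      (by have := hsI j hjI; rw [hpow] at this; nlinarith)
      (I.erase j ∪ Q) C
      (by
        intro q hq
        rw [← hpow]
        rcases mem_union.1 hq with hq | hq
        · exact hsI q (mem_of_mem_erase hq)
        · exact hsQ q hq)
      (by
        intro q hq
        rw [disjoint_left]
        intro v hv1 hv2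
        have e : j = q := (hβ j v hv1).symm.trans (hβ q v hv2)
        rcases mem_union.1 hq with hq | hq
        · exact ne_of_mem_erase hq e.symm
        · exact hjQ (e ▸ hq))
      (fun S => (∃ i ∈ I.erase j, i ∈ S) ∨ q' ≤ #(S ∩ Q))
      (by
        right
        rw [inter_eq_right.2 subset_union_right]; omega)
      (by simp; omega)
    have hnS1 : ∀ i ∈ I.erase j, i ∉ S := fun i hi hiS => hnS (Or.inl ⟨i, hi, hiS⟩)
    have hnS2 : #(S ∩ Q) < q' := by
      by_contra hcon
      exact hnS (Or.inr (not_lt.1 hcon))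
    rcases hΦ with ⟨i, hi, hiS⟩ | hΦ
    · have hc := (mem_filter.1 hiS).2
      have h1 := hSR i (mem_of_mem_erase hi) j hjI (hlt i hi) X hX (hnr.trans hc)
      have h2 : Q \ S ⊆ Q.filter (fun q => 3 ^ n * h ≤ #(uc G X (C q))) := by
        intro q hq
        rw [mem_sdiff] at hq
        exact mem_filter.2 ⟨hq.1, hnr.trans (hunc q (mem_union_right _ hq.1) hq.2)⟩
      have h3 := card_le_card h2
      have h4 := card_sdiff_add_card_inter Q S
      rw [inter_comm] at h4
      omega
    · set Q1 := ((I.erase j ∪ Q).filter (fun q => 3 ^ (n + r) * h ≤ #(cv G X (C q)))) ∩ Q with hQ1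
      have hQ1Q : Q1 ⊆ Q := inter_subset_right
      set C1 : ℕ → Finset V := fun k => if k ∈ Q then cv G X (C k) else uc G X (C k) with hC1
      have hC1C : ∀ k, C1 k ⊆ C k := by
        intro k
        simp only [hC1]
        split_ifs with hk
        · exact cv_subset _ _
        · exact uc_subset _ _
      have hC1Q : ∀ k ∈ Q, C1 k = cv G X (C k) := fun k hk => by simp [hC1, hk]
      have hC1I : ∀ k ∈ I, C1 k = uc G X (C k) := fun k hk => by
        have : k ∉ Q := fun e => lt_irrefl _ (hIQ k hk k e)
        simp [hC1, this]
      refine ih (a + 1) (I.erase j) Q1 C1 (by omega) (by rw [card_erase_of_mem hjI]; omega)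
        (fun k v hv => hβ k v (hC1C k hv))
        (fun i hi q hq => hIQ i (mem_of_mem_erase hi) q (hQ1Q hq)) hΦ ?_ ?_ ?_ ?_
      · intro i hi
        rw [hC1I i (mem_of_mem_erase hi)]
        exact hunc i (mem_union_left _ hi) (hnS1 i hi)
      · intro q hq
        rw [hC1Q q (hQ1Q hq)]
        exact (mem_filter.1 (mem_inter.1 hq).1).2
      · intro i hi k hk hik
        exact (hSR i (mem_of_mem_erase hi) k (mem_of_mem_erase hk) hik).mono hh le_rfl hQ1Q hC1C
      · intro k hk v hv
        rw [hC1Q k (hQ1Q hk)] at hv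
        obtain ⟨hv1, x, hx, hxv⟩ := mem_cv.1 hv
        refine (hcert k (hQ1Q hk) v hv1).leaf (ZU_mono (erase_subset _ _) (fun q _ => hC1C q))
          ⟨j, hjI, hX hx⟩ hxv ?_ ?_
        · rw [hβ k v hv1, hβ j x (hX hx)]; exact hIQ j hjI k (hQ1Q hk)
        · rintro z ⟨q, hq, hz⟩
          rw [hC1I q (mem_of_mem_erase hq)] at hz
          obtain ⟨hz1, hz2⟩ := mem_uc.1 hz
          refine ⟨hz2 x hx, ?_⟩
          rw [hβ j x (hX hx), hβ q z hz1]
          exact (ne_of_mem_erase hq).symm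

lemma phase2 (s ta tb : ℕ) : ∃ N : ℕ,
    ∀ (V : Type) (G : SimpleGraph V) (β : V → ℕ) (h : ℝ), 0 < h →
    (∀ v : V, ∀ D : Finset V, (#(D.filter (fun u => G.Adj v u)) : ℝ) ≤ h) →
    (∀ A D : Finset V, Disjoint A D → (∀ a ∈ A, ∀ d ∈ D, ¬ G.Adj a d) → h ≤ #A → (#D : ℝ) < h) →
    (∀ v Z, ¬ BC G β s tb v Z) → (∀ v Z, ¬ SC G β ta v Z) →
    ∀ (U : Finset ℕ) (C : ℕ → Finset V),
    (∀ k, ∀ v ∈ C k, β v = k) → N ≤ #U →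
    (∀ q ∈ U, 3 ^ N * h ≤ #(C q)) →
    (∀ k ∈ U, ∀ v ∈ C k, BC G β s 0 v (ZU (U.erase k) C)) → False := by
  obtain ⟨N, hN⟩ := chain s tb (fun n => (n + 1) * 2 ^ ta + ta + n) ta 0
  refine ⟨N, ?_⟩
  intro V G β h hh H1 H2 hb hs U C hβ hNU hsz hcert
  obtain ⟨n, -, -, I, hI, Q, hQ, C', hC', h1, h2, h3, h4, h5, h6⟩ :=
    hN V G β h hh hb U C hβ hNU hsz hcert
  have hp : ∀ {x y : ℕ}, x ≤ y → (3 : ℝ) ^ x * h ≤ 3 ^ y * h := by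
    intro x y hxy; gcongr; norm_num
  exact final ta n hh H1 H2 hs ta 0 I Q C' (by omega) h1 (fun k v hv => hβ k v (hC' k hv)) h2
    (by omega) (fun q hq => (hp (by omega)).trans (h4 q hq))
    (fun q hq => (hp (by omega)).trans (h5 q hq)) h6 (fun k _ v _ => SC.zero _ _)

end StarBroom

namespace StarBroom
open Finset Classical

lemma weight_bound {M w d ab : ℕ} (hM : 1 ≤ M) (hab : ab + 1 ≤ M) (h : w * M ≤ M + ab * M ^ d) :
    w ≤ M ^ d := by
  rcases Nat.eq_zero_or_pos d with rfl | hd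
  · simp at h ⊢
    by_contra hc
    have : 2 * M ≤ w * M := Nat.mul_le_mul_right _ (by omega)
    omega
  · have h1 : M ≤ M ^ d := Nat.le_self_pow (by omega) M
    have h2 : w * M ≤ M ^ d * M := by
      calc w * M ≤ M + ab * M ^ d := h
        _ ≤ M ^ d + ab * M ^ d := by omega
        _ = (ab + 1) * M ^ d := by ring
        _ ≤ M * M ^ d := Nat.mul_le_mul_right _ hab
        _ = M ^ d * M := by ring
    exact Nat.le_of_mul_le_mul_right h2 hM

lemma phase1 (s ta tb : ℕ) {V : Type} {G : SimpleGraph V} {β : V → ℕ} {h : ℝ} (hh : 0 < h)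
    (H1 : ∀ v : V, ∀ D : Finset V, (#(D.filter (fun u => G.Adj v u)) : ℝ) ≤ h)
    (H2 : ∀ A D : Finset V, Disjoint A D → (∀ a ∈ A, ∀ d ∈ D, ¬ G.Adj a d) → h ≤ #A → (#D : ℝ) < h)
    (hb : ∀ v Z, ¬ BC G β s tb v Z) (hs : ∀ v Z, ¬ SC G β ta v Z) (W : ℕ)
    (hW : (ta + tb) ^ s < W) :
    ∀ (n : ℕ) (U : Finset ℕ) (C : ℕ → Finset V) (d w : ℕ → ℕ),
    #(U.filter (fun k => d k < s)) ≤ n → ∑ k ∈ U, w k = W →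
    (∀ k, ∀ v ∈ C k, β v = k) → (∀ k ∈ U, 3 ^ (#U) * h ≤ #(C k)) →
    (∀ k ∈ U, d k ≤ s ∧ ∃ a b : ℕ, a < ta ∧ b < tb ∧ (d k < s → b = 0) ∧
      w k * (ta + tb) ≤ (ta + tb) + (a + b) * (ta + tb) ^ (d k) ∧
      ∀ v ∈ C k, BC G β (d k) b v (ZU (U.erase k) C) ∧ SC G β a v (ZU (U.erase k) C)) →
    ∃ (U' : Finset ℕ) (C' : ℕ → Finset V), W ≤ #U' * (ta + tb) ^ s ∧
      (∀ k, ∀ v ∈ C' k, β v = k) ∧ (∀ k ∈ U', 3 ^ (#U') * h ≤ #(C' k)) ∧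
      (∀ k ∈ U', ∀ v ∈ C' k, BC G β s 0 v (ZU (U'.erase k) C')) := by
  intro n
  induction n with
  | zero =>
    intro U C d w hn hw hβ hsz hinv
    have hd : ∀ k ∈ U, d k = s := by
      intro k hk
      have h1 := (hinv k hk).1
      by_contra hne
      have : k ∈ U.filter (fun k => d k < s) := mem_filter.2 ⟨hk, by omega⟩
      have := card_pos.2 ⟨k, this⟩
      omega
    refine ⟨U, C, ?_, hβ, hsz, ?_⟩
    · rw [← hw, ← smul_eq_mul]
      apply sum_le_card_nsmul
      intro k hk
      obtain ⟨-, a, b, ha, hb', -, hwk, -⟩ := hinv k hk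
      have := weight_bound (by omega) (by omega) hwk
      rwa [hd k hk] at this
    · intro k hk v hv
      obtain ⟨-, a, b, ha, hb', -, -, hc⟩ := hinv k hk
      have := (hc v hv).1
      rw [hd k hk] at this
      exact this.less (Nat.zero_le _)
  | succ n ih =>
    intro U C d w hn hw hβ hsz hinv
    by_cases hemp : (U.filter (fun k => d k < s)).Nonempty
    swap
    · refine ih U C d w ?_ hw hβ hsz hinv
      rw [not_nonempty_iff_eq_empty.1 hemp]; simp
    set M := ta + tb with hMdef
    set i := (U.filter (fun k => d k < s)).min' hemp with hi
    have himem := mem_filter.1 (min'_mem _ hemp)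
    rw [← hi] at himem
    obtain ⟨hiU, hids⟩ := himem
    have hmin : ∀ k ∈ U, k < i → d k = s := by
      intro k hk hki
      have h1 := (hinv k hk).1
      by_contra hne
      have := min'_le (U.filter (fun k => d k < s)) k (mem_filter.2 ⟨hk, by omega⟩)
      omega
    obtain ⟨-, ai, bi, hai, hbi, -, hwi, hci⟩ := hinv i hiU
    have hM : 2 ≤ M := by omega
    have hwiM := weight_bound (by omega) (by omega) hwi
    have hTne : (U.erase i).Nonempty := by
      rw [nonempty_iff_ne_empty]
      intro he
      have : ∑ k ∈ U, w k = w i := by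
        rw [← add_sum_erase U w hiU, he]; simp
      have h2 : M ^ (d i) ≤ M ^ s := Nat.pow_le_pow_right (by omega) hids.le
      omega
    have hcardT : #U = #(U.erase i) + 1 := by
      have := card_pos.2 ⟨i, hiU⟩
      rw [card_erase_of_mem hiU]; omega
    have hone : (1 : ℝ) ≤ 3 ^ (#(U.erase i)) := one_le_pow₀ (by norm_num)
    have hpow : (3 : ℝ) ^ (#U) = 3 * 3 ^ (#(U.erase i)) := by rw [hcardT]; ring
    obtain ⟨X, hX, hΦ, S, hS, hnS, hunc⟩ := minCover hh hone H1 H2 (C i)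
      (by have := hsz i hiU; rw [hpow] at this; nlinarith)
      (U.erase i) C
      (by
        intro q hq
        rw [← hpow]
        exact hsz q (mem_of_mem_erase hq))
      (by
        intro q hq
        rw [disjoint_left]
        intro v hv1 hv2
        have e : i = q := (hβ i v hv1).symm.trans (hβ q v hv2)
        exact ne_of_mem_erase hq e.symm)
      (fun S => S.Nonempty) hTne (by simp)
    obtain ⟨q0, hq0⟩ := hΦ
    obtain ⟨hq0T, hq0c⟩ := mem_filter.1 hq0
    have hq0U := mem_of_mem_erase hq0T
    have hq0i := ne_of_mem_erase hq0T
    have hS0 : S = ∅ := not_nonempty_iff_eq_empty.1 hnS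
    subst hS0
    set C1 : ℕ → Finset V := fun k => if k = q0 then cv G X (C k) else uc G X (C k) with hC1
    have hC1C : ∀ k, C1 k ⊆ C k := by
      intro k
      simp only [hC1]
      split_ifs with hk
      · exact cv_subset _ _
      · exact uc_subset _ _
    have hC1q : C1 q0 = cv G X (C q0) := by simp [hC1]
    have hC1n : ∀ k, k ≠ q0 → C1 k = uc G X (C k) := fun k hk => by simp [hC1, hk]
    have hZsub : ∀ k, ZU ((U.erase i).erase k) C1 ⊆ ZU (U.erase k) C := fun k =>
      ZU_mono (erase_subset_erase _ (erase_subset _ _)) (fun q _ => hC1C q)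
    have hZi : ZU ((U.erase i).erase q0) C1 ⊆ ZU (U.erase i) C :=
      ZU_mono (erase_subset _ _) (fun q _ => hC1C q)
    have hfree : ∀ x ∈ X, Free G β x (ZU ((U.erase i).erase q0) C1) := by
      rintro x hx z ⟨q, hq, hz⟩
      rw [hC1n q (ne_of_mem_erase hq)] at hz
      obtain ⟨hz1, hz2⟩ := mem_uc.1 hz
      refine ⟨hz2 x hx, ?_⟩
      rw [hβ i x (hX hx), hβ q z hz1]
      exact (ne_of_mem_erase (mem_of_mem_erase hq)).symm
    have hne1 : (C1 q0).Nonempty := by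
      rw [hC1q, ← card_pos]
      have : (0 : ℝ) < #(cv G X (C q0)) := lt_of_lt_of_le (by positivity) hq0c
      exact_mod_cast this
    set dq := if i < q0 then max (d q0) (d i + 1) else d q0 with hdq
    have hdq_ge : d q0 ≤ dq := by
      rw [hdq]; split_ifs
      · exact le_max_left _ _
      · exact le_rfl
    have hdq_i : d i + 1 ≤ dq := by
      rw [hdq]; split_ifs with hlt
      · exact le_max_right _ _
      · rw [hmin q0 hq0U (by omega)]; omega
    refine ih (U.erase i) C1 (Function.update d q0 dq) (Function.update w q0 (w q0 + w i))
      ?_ ?_ (fun k v hv => hβ k v (hC1C k hv)) ?_ ?_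
    · have : (U.erase i).filter (fun k => Function.update d q0 dq k < s) ⊆
          (U.filter (fun k => d k < s)).erase i := by
        intro k hk
        obtain ⟨hk1, hk2⟩ := mem_filter.1 hk
        refine mem_erase.2 ⟨ne_of_mem_erase hk1, mem_filter.2 ⟨mem_of_mem_erase hk1, ?_⟩⟩
        by_cases hkq : k = q0
        · subst hkq; rw [Function.update_self] at hk2; omega
        · rwa [Function.update_of_ne hkq] at hk2
      have h2 := card_le_card this
      rw [card_erase_of_mem (mem_filter.2 ⟨hiU, hids⟩)] at h2
      omega
    · rw [sum_update_of_mem hq0T, ← hw, ← add_sum_erase U w hiU, ← add_sum_erase _ w hq0T,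
        sdiff_singleton_eq_erase]
      ring
    · intro k hk
      by_cases hkq : k = q0
      · subst hkq; rw [hC1q]; exact hq0c
      · rw [hC1n k hkq]; exact hunc k hk (by simp)
    · intro k hk
      by_cases hkq : k = q0
      · subst hkq
        obtain ⟨hdk, a, b, ha, hb', hfr, hwk, hck⟩ := hinv k hq0U
        rw [Function.update_self, Function.update_self]
        have hwnew : (w k + w i) * M ≤ M + (a + b + 1) * M ^ dq := by
          have h1 : w i * M ≤ M ^ dq := by
            calc w i * M ≤ M ^ (d i) * M := Nat.mul_le_mul_right _ hwiM
              _ = M ^ (d i + 1) := by ring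
              _ ≤ M ^ dq := Nat.pow_le_pow_right (by omega) hdq_i
          have h2 : (a + b) * M ^ (d k) ≤ (a + b) * M ^ dq :=
            Nat.mul_le_mul_left _ (Nat.pow_le_pow_right (by omega) hdq_ge)
          nlinarith
        by_cases hlt : i < k
        · have hdqs : dq ≤ s := by rw [hdq, if_pos hlt]; exact max_le hdk hids
          have hSC : ∀ v ∈ C1 k, SC G β (a + 1) v (ZU ((U.erase i).erase k) C1) := by
            intro v hv
            rw [hC1q] at hv
            obtain ⟨hv1, x, hx, hxv⟩ := mem_cv.1 hv
            refine ((hck v hv1).2).leaf (hZsub k) ⟨i, mem_erase.2 ⟨hlt.ne, hiU⟩, hX hx⟩ hxv ?_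
              (hfree x hx)
            rw [hβ i x (hX hx), hβ k v hv1]; exact hlt
          refine ⟨hdqs, a + 1, b, ?_, hb', ?_, ?_, ?_⟩
          · obtain ⟨v, hv⟩ := hne1
            rcases Nat.lt_or_ge (a + 1) ta with h1 | h1
            · exact h1
            · exact absurd ((hSC v hv).less h1) (hs _ _)
          · intro h1; exact hfr (by omega)
          · rw [show a + 1 + b = a + b + 1 by ring]; exact hwnew
          · intro v hv
            refine ⟨?_, hSC v hv⟩
            rw [hC1q] at hv
            obtain ⟨hv1, x, hx, hxv⟩ := mem_cv.1 hv
            by_cases hdd : d i + 1 ≤ d k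
            · have : dq = d k := by rw [hdq, if_pos hlt]; exact max_eq_left hdd
              rw [this]
              exact ((hck v hv1).1).mono (hZsub k)
            · have : dq = d i + 1 := by rw [hdq, if_pos hlt]; exact max_eq_right (by omega)
              rw [this, hfr (by omega)]
              refine ((hci x (hX hx)).1).path hZi ⟨k, hq0T, hv1⟩ hxv ?_ (hfree x hx)
              rw [hβ i x (hX hx), hβ k v hv1]; exact hlt
        · have hki : k < i := by omega
          have hdks := hmin k hq0U hki
          have hdqk : dq = d k := by rw [hdq, if_neg hlt]
          have hBC : ∀ v ∈ C1 k, BC G β (d k) (b + 1) v (ZU ((U.erase i).erase k) C1) := by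
            intro v hv
            rw [hC1q] at hv
            obtain ⟨hv1, x, hx, hxv⟩ := mem_cv.1 hv
            refine ((hck v hv1).1).leaf (hZsub k) ⟨i, mem_erase.2 ⟨hki.ne', hiU⟩, hX hx⟩ hxv ?_
              (hfree x hx)
            rw [hβ i x (hX hx), hβ k v hv1]; exact hki
          refine ⟨by omega, a, b + 1, ha, ?_, ?_, ?_, ?_⟩
          · obtain ⟨v, hv⟩ := hne1
            rcases Nat.lt_or_ge (b + 1) tb with h1 | h1
            · exact h1
            · have := (hBC v hv).less h1
              rw [hdks] at this
              exact absurd this (hb _ _)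
          · intro h1; omega
          · exact hwnew
          · intro v hv
            rw [hdqk]
            exact ⟨hBC v hv, ((hck v (hC1C k hv)).2).mono (hZsub k)⟩
      · obtain ⟨hdk, a, b, ha, hb', hfr, hwk, hck⟩ := hinv k (mem_of_mem_erase hk)
        rw [Function.update_of_ne hkq, Function.update_of_ne hkq]
        exact ⟨hdk, a, b, ha, hb', hfr, hwk, fun v hv =>
          ⟨((hck v (hC1C k hv)).1).mono (hZsub k), ((hck v (hC1C k hv)).2).mono (hZsub k)⟩⟩

lemma core0 (s ta tb : ℕ) (hta : 0 < ta) (htb : 0 < tb) : ∃ K : ℕ, 0 < K ∧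
    ∀ (V : Type) [Fintype V] (G : SimpleGraph V) (β : V → ℕ) (h : ℝ), 0 < h →
    (∀ v : V, ∀ D : Finset V, (#(D.filter (fun u => G.Adj v u)) : ℝ) ≤ h) →
    (∀ A D : Finset V, Disjoint A D → (∀ a ∈ A, ∀ d ∈ D, ¬ G.Adj a d) → h ≤ #A → (#D : ℝ) < h) →
    (∀ k < K, 3 ^ K * h ≤ #(univ.filter (fun v => β v = k))) →
    (∃ v Z, SC G β ta v Z) ∨ (∃ v Z, BC G β s tb v Z) := by
  obtain ⟨N, hN⟩ := phase2 s ta tb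
  refine ⟨(N + 1) * (ta + tb) ^ s + 1, Nat.succ_pos _, ?_⟩
  set K := (N + 1) * (ta + tb) ^ s + 1 with hK
  intro V _ G β h hh H1 H2 hsz
  by_contra hcon
  push Not at hcon
  obtain ⟨hs, hb⟩ := hcon
  have hMpos : 0 < (ta + tb) ^ s := Nat.pow_pos (by omega)
  obtain ⟨U, C, h1, h2, h3, h4⟩ := phase1 s ta tb hh H1 H2 hb hs K
    (by rw [hK]; nlinarith) _ (range K) (fun k => univ.filter (fun v => β v = k)) (fun _ => 0)
    (fun _ => 1) le_rfl (by simp) (by simp)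
    (by intro k hk; rw [card_range]; exact hsz k (mem_range.1 hk))
    (by
      intro k hk
      exact ⟨Nat.zero_le _, 0, 0, hta, htb, fun _ => rfl, by simp, fun v _ =>
        ⟨BC.zero _ _, SC.zero _ _⟩⟩)
  have hNU : N ≤ #U := by
    by_contra hc
    have : #U * (ta + tb) ^ s ≤ (N + 1) * (ta + tb) ^ s := Nat.mul_le_mul_right _ (by omega)
    omega
  refine hN V G β h hh H1 H2 hb hs U C h2 hNU ?_ h4
  intro q hq
  refine le_trans ?_ (h3 q hq)
  gcongr
  norm_num

lemma enumS {V : Type} (β : V → ℕ) (S : Finset V) (hS : ∀ x ∈ S, ∀ y ∈ S, x ≠ y → β x ≠ β y) :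
    ∃ f : Fin #S → V, (∀ i, f i ∈ S) ∧ StrictMono (fun i => β (f i)) := by
  have hc : #(S.image β) = #S := by
    apply card_image_of_injOn
    intro x hx y hy hxy
    by_contra hne
    exact hS x hx y hy hne hxy
  have : ∀ i : Fin #S, ∃ x ∈ S, β x = (S.image β).orderEmbOfFin hc i := by
    intro i
    exact mem_image.1 (orderEmbOfFin_mem _ hc i)
  choose f hf1 hf2 using this
  refine ⟨f, hf1, ?_⟩
  intro i j hij
  simp only [hf2]
  exact ((S.image β).orderEmbOfFin hc).strictMono hij

lemma SC.out {V : Type} {G : SimpleGraph V} {β : V → ℕ} {a : ℕ} {v : V} {Z : Set V}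
    (h : SC G β a v Z) {n : ℕ} (hn : n = a + 1) :
    ∃ f : Fin n → V, StrictMono (fun i => β (f i)) ∧
      ∀ i j : Fin n, i < j → (G.Adj (f i) (f j) ↔ j.val = n - 1) := by
  obtain ⟨S, h1, h2, h3⟩ := h
  obtain ⟨e, he, hm⟩ := enumS β S (fun x hx y hy hne => (h3 x hx y hy hne).2)
  subst h1
  refine ⟨fun i => if hi : i.val < #S then e ⟨i.val, hi⟩ else v, ?_, ?_⟩
  · intro i j hij
    have hij' : i.val < j.val := hij
    have hj := j.2
    have hi : i.val < #S := by omega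
    simp only [hi, dif_pos]
    split_ifs with hj
    · exact hm (show (⟨i.val, hi⟩ : Fin #S) < ⟨j.val, hj⟩ from hij')
    · exact (h2 _ (he _)).2.1
  · intro i j hij
    have hij' : i.val < j.val := hij
    have hj := j.2
    have hi : i.val < #S := by omega
    simp only [hi, dif_pos]
    split_ifs with hj
    · have hl := hm (show (⟨i.val, hi⟩ : Fin #S) < ⟨j.val, hj⟩ from hij')
      have hne : e ⟨i.val, hi⟩ ≠ e ⟨j.val, hj⟩ := by
        intro hq; simp only [hq] at hl; exact lt_irrefl _ hl
      have := (h3 _ (he _) _ (he _) hne).1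
      constructor
      · intro h; exact absurd h this
      · intro h; omega
    · constructor
      · intro _; omega
      · intro _; exact (h2 _ (he _)).1

lemma BC.out {V : Type} {G : SimpleGraph V} {β : V → ℕ} {b m : ℕ} {v : V} {Z : Set V}
    (hm1 : 1 ≤ m) (h : BC G β (m - 1) b v Z) {n : ℕ} (hn : n = m + b) :
    ∃ f : Fin n → V, StrictMono (fun i => β (f i)) ∧
      ∀ i j : Fin n, i < j → (G.Adj (f i) (f j) ↔
        ((j.val = i.val + 1 ∧ j.val ≤ m - 1) ∨ (i.val = m - 1 ∧ m ≤ j.val))) := by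
  obtain ⟨w, S, h1, h2, -, h4, h5, h6⟩ := h
  obtain ⟨e, he, hm⟩ := enumS β S (fun x hx y hy hne => (h6 x hx y hy hne).2)
  subst h4
  have hwv : ∀ i, i < m → β (w i) ≤ β v := by
    intro i hi
    rcases Nat.lt_or_ge i (m - 1) with h | h
    · have := (h2 i (m - 1) h le_rfl).1
      rw [h1] at this; exact this.le
    · rw [show i = m - 1 by omega, h1]
  refine ⟨fun i => if hi : i.val < m then w i.val else e ⟨i.val - m, by omega⟩, ?_, ?_⟩
  · intro i j hij
    have hij' : i.val < j.val := hij
    have hj := j.2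
    simp only
    split_ifs with hi hj hj
    · exact (h2 _ _ hij' (by omega)).1
    · exact lt_of_le_of_lt (hwv _ hi) (h5 _ (he _)).2.1
    · omega
    · apply hm
      show i.val - m < j.val - m
      omega
  · intro i j hij
    have hij' : i.val < j.val := hij
    have hj := j.2
    simp only
    split_ifs with hi hj hj
    · rw [(h2 _ _ hij' (by omega)).2]
      omega
    · have h7 := h5 _ (he ⟨j.val - m, by omega⟩)
      rcases Nat.lt_or_ge i.val (m - 1) with h | h
      · have := h7.2.2.2 i.val h
        constructor
        · intro h8; exact absurd h8 this
        · intro h8; omega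
      · rw [show i.val = m - 1 by omega, h1]
        constructor
        · intro _; omega
        · intro _; exact h7.1.symm
    · omega
    · have hl : β (e ⟨i.val - m, by omega⟩) < β (e ⟨j.val - m, by omega⟩) := by
        apply hm
        show i.val - m < j.val - m
        omega
      have hne : e ⟨i.val - m, by omega⟩ ≠ e ⟨j.val - m, by omega⟩ := by
        intro hq; rw [hq] at hl; exact lt_irrefl _ hl
      have := (h6 _ (he _) _ (he _) hne).1
      constructor
      · intro h; exact absurd h this
      · intro h; omega

end StarBroom

namespace StarBroom
open Finset Classical

lemma top (n₁ n₂ m : ℕ) (h1 : 0 < n₁) (hm : 1 ≤ m) (hmn : m ≤ n₂) :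
    ∃ c : ℝ, 0 < c ∧ c < 1 ∧ ∀ (n k : ℕ) (G : SimpleGraph (Fin n)) (B : Fin k → Finset (Fin n))
      (σ : Fin k ≃ Fin k), IsBlockade B → 1 / c ≤ (k : ℝ) →
      (∀ v, (gdeg G v : ℝ) < c * blockadeWidth B) →
      ¬ HasAnticompletePair G (c * blockadeWidth B) →
      (∃ (f : Fin n₁ → Fin n) (g : Fin n₁ → Fin k), StrictMono (fun i => σ (g i)) ∧
        (∀ u, f u ∈ B (g u)) ∧ ∀ i j, i < j → (G.Adj (f i) (f j) ↔ j.val = n₁ - 1)) ∨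
      (∃ (f : Fin n₂ → Fin n) (g : Fin n₂ → Fin k), StrictMono (fun i => σ (g i)) ∧
        (∀ u, f u ∈ B (g u)) ∧ ∀ i j, i < j → (G.Adj (f i) (f j) ↔
          ((j.val = i.val + 1 ∧ j.val ≤ m - 1) ∨ (i.val = m - 1 ∧ m ≤ j.val)))) := by
  obtain ⟨K, hK, core⟩ := core0 (m - 1) (n₁ - 1 + 1) (n₂ - m + 1) (by omega) (by omega)
  have h3 : (0 : ℝ) < 3 ^ K := by positivity
  refine ⟨1 / 3 ^ K, by positivity, ?_, ?_⟩
  · rw [div_lt_one h3]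
    exact one_lt_pow₀ (by norm_num) (by omega)
  intro n k G B σ hB hk hdeg hanti
  have hk' : 3 ^ K ≤ k := by
    rw [one_div_one_div] at hk
    exact_mod_cast hk
  have hKk : K < k := lt_of_lt_of_le (Nat.lt_pow_self (by norm_num)) hk'
  have hWle : ∀ i, blockadeWidth B ≤ #(B i) := fun i => ciInf_le (OrderBot.bddBelow _) i
  have hW : 0 < blockadeWidth B := by
    haveI : Nonempty (Fin k) := ⟨⟨0, by omega⟩⟩
    obtain ⟨i, hi⟩ := exists_eq_ciInf_of_finite (f := fun i => #(B i))
    unfold blockadeWidth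
    rw [← hi]
    exact Finset.card_pos.mpr (hB.1 i)
  set h : ℝ := 1 / 3 ^ K * blockadeWidth B with hh
  have hpos : 0 < h := by
    have : (0 : ℝ) < blockadeWidth B := by exact_mod_cast hW
    positivity
  let V' := {v : Fin n // ∃ i, v ∈ B i}
  let ix : V' → Fin k := fun v => v.2.choose
  have hix : ∀ v : V', v.1 ∈ B (ix v) := fun v => v.2.choose_spec
  have hixu : ∀ (v : V') i, v.1 ∈ B i → ix v = i := by
    intro v i hi
    by_contra hne
    exact Finset.disjoint_left.mp (hB.2 _ _ hne) (hix v) hi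
  let em : V' ↪ Fin n := ⟨Subtype.val, Subtype.val_injective⟩
  let G' : SimpleGraph V' := G.comap Subtype.val
  let β : V' → ℕ := fun v => (σ (ix v)).val
  have key := core V' G' β h hpos ?_ ?_ ?_
  · rcases key with ⟨v, Z, hS⟩ | ⟨v, Z, hS⟩
    · left
      obtain ⟨f, hf, ha⟩ := (hS.less (Nat.le_succ (n₁ - 1))).out (n := n₁) (by omega)
      exact ⟨fun i => (f i).1, fun i => ix (f i), fun i j hij => hf hij, fun u => hix _, ha⟩
    · right
      obtain ⟨f, hf, ha⟩ := (hS.less (Nat.le_succ (n₂ - m))).out hm (n := n₂) (by omega)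
      exact ⟨fun i => (f i).1, fun i => ix (f i), fun i j hij => hf hij, fun u => hix _, ha⟩
  · intro v D
    refine le_trans ?_ (hdeg v.1).le
    norm_cast
    unfold gdeg
    rw [Nat.card_eq_card_toFinset, ← Finset.card_map em]
    apply Finset.card_le_card
    intro x hx
    simp only [Finset.mem_map, Finset.mem_filter] at hx
    obtain ⟨y, hy, rfl⟩ := hx
    have hy2 : G.Adj v.1 (em y) := hy.2
    simpa using hy2
  · intro A D hAD hno hA
    by_contra hD
    push Not at hD
    refine hanti ⟨A.map em, D.map em, (Finset.disjoint_map em).mpr hAD, ?_, by simpa using hA,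
      by simpa using hD⟩
    intro a ha d hd
    simp only [Finset.mem_map] at ha hd
    obtain ⟨a, ha, rfl⟩ := ha
    obtain ⟨d, hd, rfl⟩ := hd
    exact hno a ha d hd
  · intro i hi
    have e : (3 : ℝ) ^ K * h = blockadeWidth B := by
      rw [hh]; field_simp
    rw [e]
    norm_cast
    refine (hWle (σ.symm ⟨i, by omega⟩)).trans ?_
    rw [← Finset.card_map em]
    apply Finset.card_le_card
    intro x hx
    simp only [Finset.mem_map, Finset.mem_filter, Finset.mem_univ, true_and]
    refine ⟨⟨x, _, hx⟩, ?_, rfl⟩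
    change (σ (ix _)).val = i
    rw [hixu ⟨x, _, hx⟩ _ hx]
    simp

lemma adj_all {n N : ℕ} {H : SimpleGraph (Fin N)} {G : SimpleGraph (Fin n)} {f : Fin N → Fin n}
    (h : ∀ i j, i < j → (H.Adj i j ↔ G.Adj (f i) (f j))) (i j : Fin N) :
    H.Adj i j ↔ G.Adj (f i) (f j) := by
  rcases lt_trichotomy i j with hij | rfl | hij
  · exact h i j hij
  · simp
  · rw [H.adj_comm, G.adj_comm]
    exact h j i hij

lemma rainbow_fwd {n N k : ℕ} {H : SimpleGraph (Fin N)} {G : SimpleGraph (Fin n)}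
    {B : Fin k → Finset (Fin n)} (hR : Respectful B) (f : Fin N → Fin n) (g : Fin N → Fin k)
    (hg : StrictMono g) (hf : ∀ u, f u ∈ B (g u))
    (h : ∀ i j, i < j → (H.Adj i j ↔ G.Adj (f i) (f j))) : ORainbow G H B :=
  ⟨f, fun i j hij => hR _ _ (hg hij) _ (hf i) _ (hf j), adj_all h, g, hg.injective, hf⟩

lemma rainbow_bwd {n N k : ℕ} {H : SimpleGraph (Fin N)} {G : SimpleGraph (Fin n)}
    {B : Fin k → Finset (Fin n)} (hR : Respectful B) (f : Fin N → Fin n) (g : Fin N → Fin k)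
    (hg : StrictMono (fun i => Fin.rev (g i))) (hf : ∀ u, f u ∈ B (g u))
    (h : ∀ i j, i < j → (H.Adj i.rev j.rev ↔ G.Adj (f i) (f j))) : ORainbow G H B := by
  refine rainbow_fwd hR (fun i => f i.rev) (fun i => g i.rev) ?_ (fun u => hf _) ?_
  · intro i j hij
    exact Fin.rev_lt_rev.mp (hg (Fin.rev_lt_rev.mpr hij))
  · intro i j hij
    have := h j.rev i.rev (Fin.rev_lt_rev.mpr hij)
    rw [Fin.rev_rev, Fin.rev_rev] at this
    rw [H.adj_comm, G.adj_comm]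
    exact this

end StarBroom

/-- If `𝒜` contains a left-star and a right-broom, or a right-star and a left-broom, then
`𝒜` has the sparse rainbow strong EH-property. -/
theorem SRSEH_star_broom (𝒜 : Set OGraph)
    (h : ((∃ L ∈ 𝒜, IsLeftStar L.2) ∧ (∃ R ∈ 𝒜, IsRightBroom R.2)) ∨
         ((∃ R ∈ 𝒜, IsRightStar R.2) ∧ (∃ L ∈ 𝒜, IsLeftBroom L.2))) :
    SRSEH 𝒜 := by
  rcases h with ⟨⟨L, hL, hn, hs⟩, ⟨R, hR, hn', m, hm, hmn, hb⟩⟩ |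
    ⟨⟨R, hR, hn, hs⟩, ⟨L, hL, hn', m, hm, hmn, hb⟩⟩
  · obtain ⟨c, hc, hc1, H⟩ := StarBroom.top L.1 R.1 m hn hm hmn
    refine ⟨c, hc, hc1, fun n k G B hB hresp hk hno hdeg => ?_⟩
    by_contra hanti
    rcases H n k G B Fin.revPerm hB hk hdeg hanti with ⟨f, g, hg, hf, ha⟩ | ⟨f, g, hg, hf, ha⟩
    · refine hno L hL (StarBroom.rainbow_bwd hresp f g hg hf fun i j hij => ?_)
      have hij' := Fin.lt_def.mp hij
      rw [ha i j hij, hs]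
      simp only [ne_eq, Fin.rev_inj, Fin.val_rev, Fin.ext_iff]
      omega
    · refine hno R hR (StarBroom.rainbow_bwd hresp f g hg hf fun i j hij => ?_)
      rw [ha i j hij]
      exact hb i j hij
  · obtain ⟨c, hc, hc1, H⟩ := StarBroom.top R.1 L.1 m hn hm hmn
    refine ⟨c, hc, hc1, fun n k G B hB hresp hk hno hdeg => ?_⟩
    by_contra hanti
    rcases H n k G B (Equiv.refl _) hB hk hdeg hanti with
      ⟨f, g, hg, hf, ha⟩ | ⟨f, g, hg, hf, ha⟩
    · refine hno R hR (StarBroom.rainbow_fwd hresp f g hg hf fun i j hij => ?_)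
      have hij' := Fin.lt_def.mp hij
      rw [ha i j hij, hs]
      simp only [ne_eq, Fin.ext_iff]
      omega
    · refine hno L hL (StarBroom.rainbow_fwd hresp f g hg hf fun i j hij => ?_)
      rw [ha i j hij]
      exact hb i j hij
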